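/- For an unweighted graph (all A_{uv} ∈ {0,1}) with edge set E, any finite sequence of community assignments ℓ_0, ℓ_1, …, ℓ_T with strictly increasing modularity (Q(ℓ_{k+1}) > Q(ℓ_k) for all 0 ≤ k < T) satisfies T ≤ 8|E|²; hence the maximum possible number of modularity-increasing moves is O(|E|²). -/

import Mathlib

open Finset

theorem sum_zero_one_eq_two_mul_card {V : Type*} [Fintype V] [LinearOrder V]
    (A : V → V → ℝ) (hsym : ∀ u v, A u v = A v u) (hdiag : ∀ u, A u u = 0)
    (h01 : ∀ u v, A u v = 0 ∨ A u v = 1) :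
    ∑ u, ∑ v, A u v =
      2 * ((univ.filter (fun p : V × V => p.1 < p.2 ∧ A p.1 p.2 = 1)).card : ℝ) := by
  have hcard : ((univ.filter (fun p : V × V => p.1 < p.2 ∧ A p.1 p.2 = 1)).card : ℝ)
      = ∑ u, ∑ v, if u < v then A u v else 0 := by
    rw [Finset.card_filter, Fintype.sum_prod_type]
    push_cast
    refine sum_congr rfl fun u _ => sum_congr rfl fun v _ => ?_
    rcases h01 u v with h | h <;> simp [h]
  have hswap : ∑ u, ∑ v, (if u < v then A u v else 0)
      = ∑ u, ∑ v, if v < u then A u v else 0 := by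
    rw [sum_comm]
    exact sum_congr rfl fun u _ => sum_congr rfl fun v _ => by rw [hsym]
  rw [hcard, two_mul]
  nth_rewrite 2 [hswap]
  simp only [← sum_add_distrib]
  refine sum_congr rfl fun u _ => sum_congr rfl fun v _ => ?_
  rcases lt_trichotomy u v with h | rfl | h
  · simp [h, h.not_gt]
  · simp [hdiag]
  · simp [h, h.not_gt]

theorem sum_mul_ite_mem_Icc {V Lab : Type*} [Fintype V] [DecidableEq Lab]
    (f : V → V → ℝ) (hf : ∀ u v, 0 ≤ f u v) (l : V → Lab) :
    ∑ u, ∑ v, f u v * (if l u = l v then (1 : ℝ) else 0) ∈ Set.Icc 0 (∑ u, ∑ v, f u v) := by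
  constructor
  · exact sum_nonneg fun u _ => sum_nonneg fun v _ =>
      mul_nonneg (hf u v) (by split_ifs <;> norm_num)
  · exact sum_le_sum fun u _ => sum_le_sum fun v _ =>
      mul_le_of_le_one_right (hf u v) (by split_ifs <;> norm_num)

theorem add_natCast_le_of_forall_lt_succ (N : ℕ → ℤ) (T : ℕ)
    (h : ∀ k, k < T → N k < N (k + 1)) : N 0 + T ≤ N T := by
  induction T with
  | zero => simp
  | succ n ih =>
    have h₁ := ih fun k hk => h k (hk.trans n.lt_succ_self)
    have h₂ := h n n.lt_succ_self
    push_cast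
    lia

/-- For an unweighted graph (all `A u v ∈ {0,1}`) with (nonempty) edge set `E`, any finite
sequence of community assignments with strictly increasing modularity has length at most
`8|E|²`. -/
theorem modularity_increasing_sequence_length_unweighted
    {V Lab : Type*} [Fintype V] [LinearOrder V] [DecidableEq Lab]
    (A : V → V → ℝ)
    (hsym : ∀ u v, A u v = A v u)
    (hdiag : ∀ u, A u u = 0)
    (h01 : ∀ u v, A u v = 0 ∨ A u v = 1)
    (E : Finset (V × V))
    (hE : E = univ.filter (fun p : V × V => p.1 < p.2 ∧ A p.1 p.2 = 1))
    (hEne : E.Nonempty)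
    (s : V → ℝ) (hs : ∀ u, s u = ∑ v, A u v)
    (W : ℝ) (hW : W = (1/2) * ∑ u, ∑ v, A u v) (hWpos : 0 < W)
    (Qm : V → V → ℝ)
    (hQm : ∀ u v, Qm u v = (1/W) * (A u v - s u * s v / (2*W)))
    (Qmod : (V → Lab) → ℝ)
    (hQmod : ∀ ℓ : V → Lab,
      Qmod ℓ = (1/2) * ∑ u, ∑ v, Qm u v * (if ℓ u = ℓ v then (1:ℝ) else 0))
    (ℓseq : ℕ → V → Lab) (T : ℕ)
    (hmono : ∀ k, k < T → Qmod (ℓseq k) < Qmod (ℓseq (k+1))) :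
    (T : ℝ) ≤ 8 * (E.card : ℝ)^2 := by
  have hsum := sum_zero_one_eq_two_mul_card A hsym hdiag h01
  rw [← hE] at hsum
  have hWE : W = E.card := by rw [hW, hsum]; ring
  set m : ℝ := (E.card : ℝ) with hm
  have hA : ∀ u v, 0 ≤ A u v := fun u v => by rcases h01 u v with h | h <;> simp [h]
  have hs0 : ∀ u, 0 ≤ s u := fun u => by rw [hs]; exact sum_nonneg fun v _ => hA u v
  have hss : ∑ u, ∑ v, s u * s v = 4 * m ^ 2 := by
    rw [← sum_mul_sum]
    simp only [hs]
    rw [hsum]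
    ring
  have hQ : ∀ l : V → Lab, 4 * m ^ 2 * Qmod l =
      2 * m * (∑ u, ∑ v, A u v * (if l u = l v then (1 : ℝ) else 0))
        - ∑ u, ∑ v, s u * s v * (if l u = l v then (1 : ℝ) else 0) := by
    intro l
    have hm0 : m ≠ 0 := by rw [← hWE]; exact hWpos.ne'
    rw [hQmod]
    simp only [mul_sum, ← sum_sub_distrib]
    refine sum_congr rfl fun u _ => sum_congr rfl fun v _ => ?_
    rw [hQm, hWE]
    field_simp
    ring
  have hbound : ∀ l : V → Lab, |4 * m ^ 2 * Qmod l| ≤ 4 * m ^ 2 := by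
    intro l
    obtain ⟨ha₀, ha₁⟩ := sum_mul_ite_mem_Icc A hA l
    obtain ⟨hb₀, hb₁⟩ := sum_mul_ite_mem_Icc (fun u v => s u * s v)
      (fun u v => mul_nonneg (hs0 u) (hs0 v)) l
    rw [hsum] at ha₁
    rw [hss] at hb₁
    have hm0 : 0 < m := hWE ▸ hWpos
    rw [hQ, abs_le]
    constructor <;> nlinarith
  have hint : ∀ l : V → Lab, ∃ n : ℤ, (n : ℝ) = 4 * m ^ 2 * Qmod l := by
    have hAint : ∀ u v, ∃ n : ℤ, (n : ℝ) = A u v := fun u v => by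
      rcases h01 u v with h | h
      · exact ⟨0, by simp [h]⟩
      · exact ⟨1, by simp [h]⟩
    choose B hB using hAint
    intro l
    refine ⟨2 * E.card * (∑ u, ∑ v, B u v * (if l u = l v then 1 else 0))
      - ∑ u, ∑ v, (∑ w, B u w) * (∑ w, B v w) * (if l u = l v then 1 else 0), ?_⟩
    rw [hQ]
    push_cast
    simp only [hB, hs, hm]
  choose N hN using hint
  have hm0 : 0 < m := hWE ▸ hWpos
  have hlen := add_natCast_le_of_forall_lt_succ (fun k => N (ℓseq k)) T fun k hk => by
    have h : (N (ℓseq k) : ℝ) < N (ℓseq (k + 1)) := by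
      rw [hN, hN]
      exact mul_lt_mul_of_pos_left (hmono k hk) (by positivity)
    exact_mod_cast h
  have hlen' : (N (ℓseq 0) : ℝ) + T ≤ N (ℓseq T) := by exact_mod_cast hlen
  rw [hN, hN] at hlen'
  have h₀ := (abs_le.mp (hbound (ℓseq 0))).1
  have h₁ := (abs_le.mp (hbound (ℓseq T))).2
  linarith
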